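/- Let A ⊆ 𝕄⁴ be open and let μ : A → ℂ be twice continuously differentiable, satisfying on A the shear-free ray congruence equations ∂μ/∂v − μ·∂μ/∂z₂ = 0 and ∂μ/∂z̄₂ + μ·∂μ/∂v′ = 0. Then μ satisfies the wave equation −∂²μ/∂t² + ∂²μ/∂x₁² + ∂²μ/∂x₂² + ∂²μ/∂x₃² = 0 and the Minkowski horizontal weak conformality condition −(∂μ/∂t)² + (∂μ/∂x₁)² + (∂μ/∂x₂)² + (∂μ/∂x₃)² = 0 on A; that is, μ is a Minkowski harmonic morphism. -/

import Mathlib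

open Complex

/-- Partial derivative in the `i`-th coordinate direction of a map `𝕄⁴ = ℝ⁴ → ℂ`;
coordinates `(t, x₁, x₂, x₃)` indexed by `0, 1, 2, 3`. -/
noncomputable def pd4 (f : (Fin 4 → ℝ) → ℂ) (i : Fin 4) (x : Fin 4 → ℝ) : ℂ :=
  fderiv ℝ f x (Pi.single i 1)

/-- `∂/∂v = ½(∂/∂x₁ − ∂/∂t)`. -/
noncomputable def dv (f : (Fin 4 → ℝ) → ℂ) (x : Fin 4 → ℝ) : ℂ :=
  (pd4 f 1 x - pd4 f 0 x) / 2

/-- `∂/∂v′ = ½(∂/∂x₁ + ∂/∂t)`. -/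
noncomputable def dv' (f : (Fin 4 → ℝ) → ℂ) (x : Fin 4 → ℝ) : ℂ :=
  (pd4 f 1 x + pd4 f 0 x) / 2

/-- `∂/∂z₂ = ½(∂/∂x₂ − i ∂/∂x₃)`. -/
noncomputable def dz2 (f : (Fin 4 → ℝ) → ℂ) (x : Fin 4 → ℝ) : ℂ :=
  (pd4 f 2 x - Complex.I * pd4 f 3 x) / 2

/-- `∂/∂z̄₂ = ½(∂/∂x₂ + i ∂/∂x₃)`. -/
noncomputable def dz2b (f : (Fin 4 → ℝ) → ℂ) (x : Fin 4 → ℝ) : ℂ :=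
  (pd4 f 2 x + Complex.I * pd4 f 3 x) / 2

theorem pd4_add {f g : (Fin 4 → ℝ) → ℂ} {x : Fin 4 → ℝ} (hf : DifferentiableAt ℝ f x)
    (hg : DifferentiableAt ℝ g x) (i : Fin 4) :
    pd4 (fun y => f y + g y) i x = pd4 f i x + pd4 g i x := by
  simp [pd4, fderiv_fun_add hf hg]

theorem pd4_sub {f g : (Fin 4 → ℝ) → ℂ} {x : Fin 4 → ℝ} (hf : DifferentiableAt ℝ f x)
    (hg : DifferentiableAt ℝ g x) (i : Fin 4) :
    pd4 (fun y => f y - g y) i x = pd4 f i x - pd4 g i x := by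
  simp [pd4, fderiv_fun_sub hf hg]

theorem pd4_mul {f g : (Fin 4 → ℝ) → ℂ} {x : Fin 4 → ℝ} (hf : DifferentiableAt ℝ f x)
    (hg : DifferentiableAt ℝ g x) (i : Fin 4) :
    pd4 (fun y => f y * g y) i x = pd4 f i x * g x + f x * pd4 g i x := by
  simp [pd4, fderiv_fun_mul hf hg]
  ring

theorem pd4_const_mul {f : (Fin 4 → ℝ) → ℂ} {x : Fin 4 → ℝ} (hf : DifferentiableAt ℝ f x)
    (c : ℂ) (i : Fin 4) : pd4 (fun y => c * f y) i x = c * pd4 f i x := by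
  simp [pd4, fderiv_const_mul hf]

theorem pd4_eq_zero_of_eqOn {f : (Fin 4 → ℝ) → ℂ} {A : Set (Fin 4 → ℝ)} (hA : IsOpen A)
    (hf : ∀ y ∈ A, f y = 0) {x : Fin 4 → ℝ} (hx : x ∈ A) (i : Fin 4) : pd4 f i x = 0 := by
  have h : f =ᶠ[nhds x] fun _ => 0 := Filter.mem_of_superset (hA.mem_nhds hx) hf
  simp [pd4, h.fderiv_eq]

theorem ContDiffAt.differentiableAt_pd4 {f : (Fin 4 → ℝ) → ℂ} {x : Fin 4 → ℝ}
    (hf : ContDiffAt ℝ 2 f x) (i : Fin 4) : DifferentiableAt ℝ (pd4 f i) x :=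
  ((hf.fderiv_right (m := 1) (by norm_num)).differentiableAt one_ne_zero).clm_apply
    (differentiableAt_const _)

theorem ContDiffAt.pd4_comm {f : (Fin 4 → ℝ) → ℂ} {x : Fin 4 → ℝ}
    (hf : ContDiffAt ℝ 2 f x) (i j : Fin 4) : pd4 (pd4 f i) j x = pd4 (pd4 f j) i x := by
  have hd := (hf.fderiv_right (m := 1) (by norm_num)).differentiableAt one_ne_zero
  have key (k l : Fin 4) : pd4 (pd4 f k) l x =
      fderiv ℝ (fderiv ℝ f) x (Pi.single l 1) (Pi.single k 1) := by
    change fderiv ℝ (fun y => fderiv ℝ f y (Pi.single k 1)) x (Pi.single l 1) = _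
    simp [fderiv_clm_apply hd (differentiableAt_const _)]
  rw [key, key]
  exact hf.isSymmSndFDerivAt (by simp) _ _

/-- a `C²` solution of the shear-free ray congruence equations
`∂μ/∂v − μ ∂μ/∂z₂ = 0`, `∂μ/∂z̄₂ + μ ∂μ/∂v′ = 0` on an open subset of `𝕄⁴` is a
Minkowski harmonic morphism. -/
theorem SFR_equations_give_minkowski_harmonic_morphism
    (A : Set (Fin 4 → ℝ)) (hA : IsOpen A)
    (μ : (Fin 4 → ℝ) → ℂ)
    (hμ_C2 : ContDiffOn ℝ 2 μ A)
    (hμ_eq1 : ∀ x ∈ A, dv μ x - μ x * dz2 μ x = 0)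
    (hμ_eq2 : ∀ x ∈ A, dz2b μ x + μ x * dv' μ x = 0) :
    ∀ x ∈ A,
      (-pd4 (pd4 μ 0) 0 x + pd4 (pd4 μ 1) 1 x + pd4 (pd4 μ 2) 2 x + pd4 (pd4 μ 3) 3 x = 0) ∧
      (-(pd4 μ 0 x) ^ 2 + (pd4 μ 1 x) ^ 2 + (pd4 μ 2 x) ^ 2 + (pd4 μ 3 x) ^ 2 = 0) := by
  have eq1 : ∀ y ∈ A, pd4 μ 1 y - pd4 μ 0 y - μ y * (pd4 μ 2 y - I * pd4 μ 3 y) = 0 := by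
    intro y hy
    have h := hμ_eq1 y hy
    simp only [dv, dz2] at h
    linear_combination 2 * h
  have eq2 : ∀ y ∈ A, pd4 μ 2 y + I * pd4 μ 3 y + μ y * (pd4 μ 1 y + pd4 μ 0 y) = 0 := by
    intro y hy
    have h := hμ_eq2 y hy
    simp only [dz2b, dv'] at h
    linear_combination 2 * h
  intro x hx
  have hC : ContDiffAt ℝ 2 μ x := hμ_C2.contDiffAt (hA.mem_nhds hx)
  have hμ : DifferentiableAt ℝ μ x := hC.differentiableAt two_ne_zero
  have hd := hC.differentiableAt_pd4
  have hI : DifferentiableAt ℝ (fun y => I * pd4 μ 3 y) x := (hd 3).const_mul I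
  have deq1 (j : Fin 4) := pd4_eq_zero_of_eqOn hA eq1 hx j
  have deq2 (j : Fin 4) := pd4_eq_zero_of_eqOn hA eq2 hx j
  simp only [pd4_sub ((hd 1).fun_sub (hd 0)) (hμ.fun_mul ((hd 2).fun_sub hI)),
    pd4_sub (hd 1) (hd 0), pd4_mul hμ ((hd 2).fun_sub hI), pd4_sub (hd 2) hI,
    pd4_const_mul (hd 3)] at deq1
  simp only [pd4_add ((hd 2).fun_add hI) (hμ.fun_mul ((hd 1).fun_add (hd 0))),
    pd4_add (hd 2) hI, pd4_mul hμ ((hd 1).fun_add (hd 0)), pd4_add (hd 1) (hd 0),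
    pd4_const_mul (hd 3)] at deq2
  have e1 := eq1 x hx
  have e2 := eq2 x hx
  constructor
  · have a0 := deq1 0
    have a1 := deq1 1
    have b2 := deq2 2
    have b3 := deq2 3
    rw [hC.pd4_comm 1 0, hC.pd4_comm 2 0, hC.pd4_comm 3 0] at a0
    rw [hC.pd4_comm 2 1, hC.pd4_comm 3 1] at a1
    rw [hC.pd4_comm 3 2] at b2
    linear_combination a0 + a1 + b2 - I * b3 + pd4 (pd4 μ 3) 3 x * I_sq
  · linear_combination (pd4 μ 1 x + pd4 μ 0 x) * e1 + (pd4 μ 2 x - I * pd4 μ 3 x) * e2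
      + (pd4 μ 3 x) ^ 2 * I_sq
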